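/- Explicit bound from the minimal bad sequence data: Let (X, ≤) be a preorder with a distinguished element 0_X, let u : ℕ → X* be a sequence of words, and let pⁿ : ℕ → X* (n ≥ 0) and fⁿ : (ℕ → X*) → ℕ satisfy, with p⁻¹ := u: (1) p^{n-1}_i = pⁿ_i for all i < n; (2) for all n, j: ¬θ(pⁿ, j) → ¬θ(p^{n-1}, j); (3) for all n, q: q ≺ₙ pⁿ → ¬θ(q, fⁿ(q)). Let lt(p)_i denote the last letter of p^i_i (or 0_X if p^i_i is empty) and ft(p)_i the word p^i_i with its last letter removed. Suppose g : ℕ → ℕ is strictly increasing and satisfies lt(p)_{g(i)} ≤ lt(p)_{g(j)} for all i < j. Define ψ : ℕ → X* by ψ_i := p^{g(0)-1}_i for i < g(0) and ψ_{g(0)+i} := ft(p)_{g(i)} for i ≥ 0. Then there exist i₀ < i₁ ≤ g(f^{g(0)}(ψ)) + 1 with u_{i₀} ≤* u_{i₁}. -/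

import Mathlib

/-- Word embedding: `a ≤* b` iff there is a strictly increasing map from the
positions of `a` to the positions of `b` which is pointwise `≤`. -/
def WordLE {X : Type*} [Preorder X] (a b : List X) : Prop :=
  ∃ f : Fin a.length → Fin b.length, StrictMono f ∧ ∀ i, a.get i ≤ b.get (f i)

/-- `θ(u, j)`: the sequence `u` is bad up to stage `j`. -/
def Theta {X : Type*} [Preorder X] (u : ℕ → List X) (j : ℕ) : Prop :=
  ∀ i₀ i₁, i₀ < i₁ → i₁ ≤ j → ¬ WordLE (u i₀) (u i₁)

/-- `u ≺ₙ v`: `u` agrees with `v` below `n` and `u n` is a proper prefix of `v n`. -/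
def LexBelow {X : Type*} (n : ℕ) (u v : ℕ → List X) : Prop :=
  (∀ i, i < n → u i = v i) ∧ (u n).length < (v n).length ∧ u n = (v n).take (u n).length

/-- The family `pⁿ` extended by `p⁻¹ := u`: `prevSeq u p n` is `p^{n-1}`. -/
def prevSeq {X : Type*} (u : ℕ → List X) (p : ℕ → ℕ → List X) : ℕ → ℕ → List X
  | 0 => u
  | (n + 1) => p n

/-- `lt(p)_i`: the last letter of the diagonal word `p^i_i` (or `x0` if empty). -/
def lastLetter {X : Type*} (x0 : X) (p : ℕ → ℕ → List X) (i : ℕ) : X :=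
  (p i i).getLastD x0

/-- `ft(p)_i`: the diagonal word `p^i_i` with its last letter removed. -/
def frontWord {X : Type*} (p : ℕ → ℕ → List X) (i : ℕ) : List X :=
  (p i i).dropLast

theorem WordLE.of_nil {X : Type*} [Preorder X] (b : List X) : WordLE [] b :=
  ⟨fun i => i.elim0, fun i => i.elim0, fun i => i.elim0⟩

theorem WordLE.append_right {X : Type*} [Preorder X] {a b : List X} (h : WordLE a b)
    (c : List X) : WordLE a (b ++ c) := by
  obtain ⟨f, hf, hle⟩ := h
  refine ⟨fun i => ⟨f i, by rw [List.length_append]; omega⟩, fun i j hij => hf hij, fun i => ?_⟩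
  simpa using hle i

theorem WordLE.concat {X : Type*} [Preorder X] {a b : List X} {x y : X} (h : WordLE a b)
    (hxy : x ≤ y) : WordLE (a ++ [x]) (b ++ [y]) := by
  obtain ⟨f, hf, hle⟩ := h
  refine ⟨fun i => if hi : i.1 < a.length then ⟨f ⟨i, hi⟩, by simp⟩
    else ⟨b.length, by simp⟩, fun i j hij => ?_, fun i => ?_⟩
  · have hij' : i.1 < j.1 := hij
    have hj := j.2
    simp only [List.length_append, List.length_singleton] at hj
    have hi : i.1 < a.length := by omega
    by_cases hja : j.1 < a.length
    · have : f ⟨i, hi⟩ < f ⟨j, hja⟩ := hf hij'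
      simpa [hi, hja] using this
    · simp [hi, hja]
  · by_cases hi : i.1 < a.length
    · simpa [hi, List.getElem_append_left] using hle ⟨i, hi⟩
    · simpa [hi, List.getElem_append_right (Nat.le_of_not_lt hi)] using hxy

theorem WordLE.of_dropLast_right {X : Type*} [Preorder X] {a b : List X}
    (h : WordLE a b.dropLast) : WordLE a b := by
  rcases eq_or_ne b [] with rfl | hb
  · simpa using h
  · simpa [List.dropLast_append_getLast hb] using h.append_right [b.getLast hb]

theorem WordLE.of_dropLast {X : Type*} [Preorder X] {a b : List X} (x0 : X) (hb : b ≠ [])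
    (h : WordLE a.dropLast b.dropLast) (hlast : a.getLastD x0 ≤ b.getLastD x0) :
    WordLE a b := by
  rcases eq_or_ne a [] with rfl | ha
  · exact WordLE.of_nil b
  · rw [← List.dropLast_append_getLast ha, ← List.dropLast_append_getLast hb]
    refine h.concat ?_
    simpa [List.getLastD_eq_getLast?, List.getLast?_eq_some_getLast, ha, hb] using hlast

theorem not_theta_iff {X : Type*} [Preorder X] {u : ℕ → List X} {j : ℕ} :
    ¬ Theta u j ↔ ∃ i₀ i₁, i₀ < i₁ ∧ i₁ ≤ j ∧ WordLE (u i₀) (u i₁) := by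
  simp [Theta]

theorem not_theta_of_prevSeq {X : Type*} [Preorder X] {u : ℕ → List X}
    {p : ℕ → ℕ → List X} (h2 : ∀ n j, ¬ Theta (p n) j → ¬ Theta (prevSeq u p n) j)
    (n j : ℕ) (h : ¬ Theta (p n) j) : ¬ Theta u j := by
  induction n with
  | zero => exact h2 0 j h
  | succ n ih => exact ih (h2 (n + 1) j h)

theorem eq_diagonal_of_prevSeq {X : Type*} {u : ℕ → List X} {p : ℕ → ℕ → List X}
    (h1 : ∀ n, ∀ i, i < n → prevSeq u p n i = p n i) {i n : ℕ} (h : i ≤ n) :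
    p n i = p i i := by
  induction n, h using Nat.le_induction with
  | base => rfl
  | succ n hn ih => exact (h1 (n + 1) i (by omega)).symm.trans ih

theorem exists_wordLE_of_diagonal {X : Type*} [Preorder X] {u : ℕ → List X}
    {p : ℕ → ℕ → List X} (h1 : ∀ n, ∀ i, i < n → prevSeq u p n i = p n i)
    (h2 : ∀ n j, ¬ Theta (p n) j → ¬ Theta (prevSeq u p n) j) {a b k : ℕ} (hab : a < b)
    (hbk : b ≤ k) (h : WordLE (p a a) (p b b)) :
    ∃ i₀ i₁, i₀ < i₁ ∧ i₁ ≤ k ∧ WordLE (u i₀) (u i₁) :=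
  not_theta_iff.1 <| not_theta_of_prevSeq h2 b k <| not_theta_iff.2
    ⟨a, b, hab, hbk, by rwa [eq_diagonal_of_prevSeq h1 hab.le]⟩

/-- Explicit bound from the minimal bad sequence data. -/
theorem explicit_bound_from_mbs {X : Type*} [Preorder X] (x0 : X)
    (u : ℕ → List X) (p : ℕ → ℕ → List X) (f : ℕ → (ℕ → List X) → ℕ)
    (h1 : ∀ n, ∀ i, i < n → prevSeq u p n i = p n i)
    (h2 : ∀ n j, ¬ Theta (p n) j → ¬ Theta (prevSeq u p n) j)
    (h3 : ∀ n (q : ℕ → List X), LexBelow n q (p n) → ¬ Theta q (f n q))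
    (g : ℕ → ℕ) (hg : StrictMono g)
    (hmono : ∀ i j, i < j → lastLetter x0 p (g i) ≤ lastLetter x0 p (g j)) :
    ∃ i₀ i₁, i₀ < i₁ ∧
      i₁ ≤ g (f (g 0) (fun i => if i < g 0 then p (g 0 - 1) i
                                else frontWord p (g (i - g 0)))) + 1 ∧
      WordLE (u i₀) (u i₁) := by
  set ψ : ℕ → List X := fun i => if i < g 0 then p (g 0 - 1) i
    else frontWord p (g (i - g 0)) with hψ
  have hlow : ∀ i, i < g 0 → ψ i = p i i := fun i hi => by
    simp only [hψ, if_pos hi]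
    exact eq_diagonal_of_prevSeq h1 (by omega)
  have hhigh : ∀ i, g 0 ≤ i → ψ i = (p (g (i - g 0)) (g (i - g 0))).dropLast := fun i hi => by
    simp only [hψ, if_neg hi.not_gt, frontWord]
  set j := f (g 0) ψ
  have hempty : ∀ b, b ≤ g j → p b b = [] →
      ∃ i₀ i₁, i₀ < i₁ ∧ i₁ ≤ g j + 1 ∧ WordLE (u i₀) (u i₁) := fun b hb hnil =>
    exists_wordLE_of_diagonal h1 h2 b.lt_succ_self (by omega) (hnil ▸ WordLE.of_nil _)
  by_cases h0 : p (g 0) (g 0) = []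
  · exact hempty _ (hg.monotone j.zero_le) h0
  have hψ0 : ψ (g 0) = (p (g 0) (g 0)).dropLast := by simpa using hhigh (g 0) le_rfl
  have hbelow : LexBelow (g 0) ψ (p (g 0)) := by
    refine ⟨fun i hi => (hlow i hi).trans (eq_diagonal_of_prevSeq h1 hi.le).symm, ?_, ?_⟩
    · have := List.length_pos_iff.2 h0
      rw [hψ0, List.length_dropLast]
      omega
    · rw [hψ0, List.length_dropLast, List.dropLast_eq_take]
  obtain ⟨i₀, i₁, hlt, hle, hw⟩ := not_theta_iff.1 (h3 _ _ hbelow)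
  have hgj : g (i₁ - g 0) ≤ g j := hg.monotone (by omega)
  rcases lt_or_ge i₁ (g 0) with hi₁ | hi₁
  · rw [hlow i₀ (hlt.trans hi₁), hlow i₁ hi₁] at hw
    have := hg.le_apply (x := j)
    exact exists_wordLE_of_diagonal h1 h2 hlt (by omega) hw
  rw [hhigh i₁ hi₁] at hw
  rcases lt_or_ge i₀ (g 0) with hi₀ | hi₀
  · rw [hlow i₀ hi₀] at hw
    have : g 0 ≤ g (i₁ - g 0) := hg.monotone (Nat.zero_le _)
    exact exists_wordLE_of_diagonal h1 h2 (by omega) (by omega) hw.of_dropLast_right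
  · rw [hhigh i₀ hi₀] at hw
    by_cases hb : p (g (i₁ - g 0)) (g (i₁ - g 0)) = []
    · exact hempty _ hgj hb
    have hsub : i₀ - g 0 < i₁ - g 0 := by omega
    exact exists_wordLE_of_diagonal h1 h2 (hg hsub) (by omega)
      (hw.of_dropLast x0 hb (hmono _ _ hsub))
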